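/- Fix θ ∈ Θ and x ∈ Ω, let y = g(x,θ), and let φ : ℝⁿ → ℝ be continuously differentiable. Define the velocity field v(y,θ) = ∂_θ g(x',θ) evaluated at x' = g⁻¹(y,θ), and the transformed density f̃(y,θ) = f(g⁻¹(y,θ),θ) |det J_{g⁻¹}(y,θ)|. Then div_y( φ(y) f̃(y,θ) v(y,θ) ) = |det J_{g⁻¹}(y,θ)| · div_x( φ(g(x,θ)) f(x,θ) s(x,θ) ), where the left-hand divergence is taken with respect to y at y = g(x,θ) and the right-hand divergence with respect to x. -/

import Mathlib

open MeasureTheory Set Filter Matrix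

/-- Divergence of a vector field on `ℝⁿ`: `div w = ∑ i ∂_{xᵢ} wᵢ`. -/
noncomputable def pdiv {n : ℕ} (w : (Fin n → ℝ) → (Fin n → ℝ)) (x : Fin n → ℝ) : ℝ :=
  ∑ i : Fin n, fderiv ℝ w x (Pi.single i 1) i

/-- Jacobian matrix of a map `ℝⁿ → ℝⁿ`. -/
noncomputable def jac {n : ℕ} (g : (Fin n → ℝ) → (Fin n → ℝ)) (x : Fin n → ℝ) :
    Matrix (Fin n) (Fin n) ℝ :=
  Matrix.of fun i j => fderiv ℝ g x (Pi.single j 1) i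

/-- `s(x,θ) = J_g(x,θ)⁻¹ ∂_θ g(x,θ)`. -/
noncomputable def svec {n : ℕ} (g : (Fin n → ℝ) → ℝ → (Fin n → ℝ))
    (x : Fin n → ℝ) (θ : ℝ) : Fin n → ℝ :=
  (jac (fun x' => g x' θ) x)⁻¹ *ᵥ deriv (fun t => g x t) θ

section helpers

lemma aux_det_diff {n : ℕ} :
    Differentiable ℝ (fun A : (Fin n → ℝ) →L[ℝ] (Fin n → ℝ) => A.det) := by
  have : (fun A : (Fin n → ℝ) →L[ℝ] (Fin n → ℝ) => A.det) =
      fun A => ∑ σ : Equiv.Perm (Fin n), ((Equiv.Perm.sign σ : ℤ) : ℝ) *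
        ∏ i, A (Pi.single i 1) (σ i) := by
    funext A
    rw [ContinuousLinearMap.det, ← LinearMap.det_toMatrix', Matrix.det_apply']
    rfl
  rw [this]
  fun_prop

lemma aux_det_fderiv {n : ℕ} (A : (Fin n → ℝ) ≃L[ℝ] (Fin n → ℝ))
    (B : (Fin n → ℝ) →L[ℝ] (Fin n → ℝ)) :
    fderiv ℝ (fun A : (Fin n → ℝ) →L[ℝ] (Fin n → ℝ) => A.det) A B =
      (A : (Fin n → ℝ) →L[ℝ] (Fin n → ℝ)).det *
        LinearMap.trace ℝ (Fin n → ℝ)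
          (((A.symm : (Fin n → ℝ) →L[ℝ] (Fin n → ℝ)) ∘L B :
            (Fin n → ℝ) →L[ℝ] (Fin n → ℝ)) : (Fin n → ℝ) →ₗ[ℝ] (Fin n → ℝ)) := by
  set C : (Fin n → ℝ) →L[ℝ] (Fin n → ℝ) :=
    (A.symm : (Fin n → ℝ) →L[ℝ] (Fin n → ℝ)) ∘L B with hC
  set M := LinearMap.toMatrix' (C : (Fin n → ℝ) →ₗ[ℝ] (Fin n → ℝ)) with hM
  have h1 : HasDerivAt (fun t : ℝ => ((A : (Fin n → ℝ) →L[ℝ] (Fin n → ℝ)) + t • B).det)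
      (fderiv ℝ (fun A : (Fin n → ℝ) →L[ℝ] (Fin n → ℝ) => A.det) A B) 0 := by
    have hd := (aux_det_diff (n := n)
      (A : (Fin n → ℝ) →L[ℝ] (Fin n → ℝ))).hasFDerivAt
    exact hd.hasLineDerivAt B
  have h2 : ∀ t : ℝ, ((A : (Fin n → ℝ) →L[ℝ] (Fin n → ℝ)) + t • B).det =
      (A : (Fin n → ℝ) →L[ℝ] (Fin n → ℝ)).det * (1 + M.trace * t +
        (Matrix.det (1 + (Polynomial.X : Polynomial ℝ) • M.map Polynomial.C)).divX.divX.eval t * t ^ 2) := by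
    intro t
    rw [← Matrix.det_one_add_smul]
    have : ((A : (Fin n → ℝ) →L[ℝ] (Fin n → ℝ)) + t • B) =
        (A : (Fin n → ℝ) →L[ℝ] (Fin n → ℝ)) ∘L (ContinuousLinearMap.id ℝ _ + t • C) := by
      ext1 v
      simp [hC]
    rw [this]
    simp only [ContinuousLinearMap.det]
    rw [ContinuousLinearMap.toLinearMap_comp, LinearMap.det_comp]
    congr 1
    rw [← LinearMap.det_toMatrix']
    congr 1
    ext i j
    simp [hM, LinearMap.toMatrix'_apply, Matrix.one_apply, Pi.single_apply]
  have h3 : M.trace = LinearMap.trace ℝ (Fin n → ℝ) (C : (Fin n → ℝ) →ₗ[ℝ] (Fin n → ℝ)) := by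
    rw [LinearMap.trace_eq_matrix_trace ℝ (Pi.basisFun ℝ (Fin n))]
    rfl
  rw [← h3]
  refine h1.unique ?_
  rw [funext h2]
  generalize (Matrix.det (1 + (Polynomial.X : Polynomial ℝ) • M.map Polynomial.C)).divX.divX = p
  have := ((((hasDerivAt_id (0:ℝ)).const_mul M.trace).const_add 1).add
    ((p.hasDerivAt 0).mul (hasDerivAt_pow 2 (0:ℝ)))).const_mul
      ((A : (Fin n → ℝ) →L[ℝ] (Fin n → ℝ)).det)
  convert! this using 1
  simp

lemma aux_pdiv {n : ℕ} (w : (Fin n → ℝ) → (Fin n → ℝ)) (x : Fin n → ℝ) :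
    pdiv w x = LinearMap.trace ℝ (Fin n → ℝ)
      (fderiv ℝ w x : (Fin n → ℝ) →ₗ[ℝ] (Fin n → ℝ)) := by
  rw [LinearMap.trace_eq_matrix_trace ℝ (Pi.basisFun ℝ (Fin n))]
  rfl

lemma aux_jac_det {n : ℕ} (w : (Fin n → ℝ) → (Fin n → ℝ)) (x : Fin n → ℝ) :
    (jac w x).det = (fderiv ℝ w x).det := by
  rw [ContinuousLinearMap.det, ← LinearMap.det_toMatrix']
  rfl

lemma aux_jac_mulVec {n : ℕ} (w : (Fin n → ℝ) → (Fin n → ℝ)) (x v : Fin n → ℝ) :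
    (jac w x) *ᵥ v = fderiv ℝ w x v := by
  have : jac w x = LinearMap.toMatrix' (fderiv ℝ w x : (Fin n → ℝ) →ₗ[ℝ] (Fin n → ℝ)) := rfl
  rw [this, LinearMap.toMatrix'_mulVec]
  rfl

lemma aux_main {n : ℕ} (G H w S : (Fin n → ℝ) → (Fin n → ℝ)) (x : Fin n → ℝ)
    (hG : ContDiffAt ℝ 2 G x) (A : (Fin n → ℝ) ≃L[ℝ] (Fin n → ℝ))
    (hA : fderiv ℝ G x = A)
    (hH : HasFDerivAt H (A.symm : (Fin n → ℝ) →L[ℝ] (Fin n → ℝ)) (G x))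
    (hHG : ∀ᶠ x' in nhds x, H (G x') = x')
    (hdet : ∀ᶠ x' in nhds x, (fderiv ℝ G x').det ≠ 0)
    (hw : ∀ᶠ x' in nhds x, w (G x') = |(fderiv ℝ G x').det|⁻¹ • (fderiv ℝ G x') (S x')) :
    pdiv w (G x) = |(fderiv ℝ G x).det|⁻¹ * pdiv S x := by
  have hx1 := hHG.self_of_nhds
  have hGd : HasFDerivAt G (A : (Fin n → ℝ) →L[ℝ] (Fin n → ℝ)) x := by
    rw [← hA]; exact (hG.differentiableAt (by norm_num)).hasFDerivAt
  have hGs : HasStrictFDerivAt G (A : (Fin n → ℝ) →L[ℝ] (Fin n → ℝ)) x :=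
    hG.hasStrictFDerivAt' hGd (by norm_num)
  have hL : DifferentiableAt ℝ (fderiv ℝ G) x :=
    (hG.fderiv_right (m := 1) (by norm_num)).differentiableAt (by norm_num)
  set L' := fderiv ℝ (fderiv ℝ G) x with hL'
  have hsymm : ∀ u v, L' u v = L' v u := by
    have := hG.isSymmSndFDerivAt (by simp)
    intro u v
    exact this u v
  set d : (Fin n → ℝ) → ℝ := fun x' => (fderiv ℝ G x').det with hd
  have hd0 : d x ≠ 0 := hdet.self_of_nhds
  set τ : (Fin n → ℝ) → ℝ := fun ξ => LinearMap.trace ℝ (Fin n → ℝ)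
    (((A.symm : (Fin n → ℝ) →L[ℝ] (Fin n → ℝ)) ∘L (L' ξ) :
      (Fin n → ℝ) →L[ℝ] (Fin n → ℝ)) : (Fin n → ℝ) →ₗ[ℝ] (Fin n → ℝ)) with hτ
  have hdd : HasFDerivAt d ((fderiv ℝ (fun A : (Fin n → ℝ) →L[ℝ] (Fin n → ℝ) => A.det)
      (fderiv ℝ G x)) ∘L L') x :=
    HasFDerivAt.comp x (aux_det_diff (fderiv ℝ G x)).hasFDerivAt hL.hasFDerivAt
  set D := (fderiv ℝ (fun A : (Fin n → ℝ) →L[ℝ] (Fin n → ℝ) => A.det)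
      (fderiv ℝ G x)) ∘L L' with hD
  have hDτ : ∀ ξ, D ξ = d x * τ ξ := by
    intro ξ
    simp only [hD, hd, hτ, ContinuousLinearMap.comp_apply, hA]
    exact aux_det_fderiv A (L' ξ)
  have hc : ∃ c' : (Fin n → ℝ) →L[ℝ] ℝ, HasFDerivAt (fun x' => |d x'|⁻¹) c' x ∧
      ∀ ξ, c' ξ = - |d x|⁻¹ * τ ξ := by
    have h1 := ((hasDerivAt_abs hd0).inv (abs_ne_zero.2 hd0)).comp_hasFDerivAt x hdd
    refine ⟨_, h1, fun ξ => ?_⟩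
    simp only [ContinuousLinearMap.smul_apply, hDτ, smul_eq_mul]
    rcases lt_or_gt_of_ne hd0 with h | h
    · simp [abs_of_neg h, sign_neg h]; field_simp
    · simp [abs_of_pos h, sign_pos h]; field_simp
  obtain ⟨c', hc', hc'τ⟩ := hc
  by_cases hS : DifferentiableAt ℝ S x
  · obtain ⟨P', hPe, hP⟩ : ∃ P', P' = |d x|⁻¹ • (fderiv ℝ G x ∘L fderiv ℝ S x + L'.flip (S x)) +
        c'.smulRight ((fderiv ℝ G x) (S x)) ∧
        HasFDerivAt (fun x' => |d x'|⁻¹ • (fderiv ℝ G x') (S x')) P' x :=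
      ⟨_, rfl, hc'.smul (hL.hasFDerivAt.clm_apply hS.hasFDerivAt)⟩
    have hwH : w =ᶠ[nhds (G x)] (fun x' => |d x'|⁻¹ • (fderiv ℝ G x') (S x')) ∘ H := by
      have : ∀ᶠ y in Filter.map G (nhds x),
          w y = ((fun x' => |d x'|⁻¹ • (fderiv ℝ G x') (S x')) ∘ H) y := by
        rw [Filter.eventually_map]
        filter_upwards [hHG, hw] with z h1 h2
        simp only [Function.comp, h1]
        exact h2
      rwa [hGs.map_nhds_eq_of_equiv] at this
    have hw' : HasFDerivAt w _ (G x) :=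
      (HasFDerivAt.comp (G x) (by rw [hx1]; exact hP) hH).congr_of_eventuallyEq hwH
    rw [aux_pdiv, aux_pdiv, hw'.fderiv, ContinuousLinearMap.toLinearMap_comp,
      LinearMap.trace_comp_comm', ← ContinuousLinearMap.toLinearMap_comp]
    have key : (A.symm : (Fin n → ℝ) →L[ℝ] (Fin n → ℝ)) ∘L P' =
        c'.smulRight (S x) + |d x|⁻¹ • ((A.symm : (Fin n → ℝ) →L[ℝ] (Fin n → ℝ)) ∘L (L' (S x)))
          + |d x|⁻¹ • fderiv ℝ S x := by
      ext1 ξ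
      simp [hPe, hA, hsymm ξ (S x)]
      abel
    rw [key]
    have htr : LinearMap.trace ℝ (Fin n → ℝ)
        ((c'.smulRight (S x) : (Fin n → ℝ) →L[ℝ] (Fin n → ℝ)) : (Fin n → ℝ) →ₗ[ℝ] (Fin n → ℝ))
        = c' (S x) := by
      exact LinearMap.trace_smulRight (c' : (Fin n → ℝ) →ₗ[ℝ] ℝ) (S x)
    simp only [ContinuousLinearMap.toLinearMap_add, ContinuousLinearMap.toLinearMap_smul, map_add,
      map_smul, htr, hc'τ, smul_eq_mul]
    simp only [hτ]
    ring
  · have hwn : ¬ DifferentiableAt ℝ w (G x) := by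
      intro hwd
      apply hS
      have hI : DifferentiableAt ℝ (fun x' => ContinuousLinearMap.inverse (fderiv ℝ G x')) x := by
        have h1 : DifferentiableAt ℝ (ContinuousLinearMap.inverse :
            ((Fin n → ℝ) →L[ℝ] (Fin n → ℝ)) → _) (fderiv ℝ G x) := by
          rw [hA]
          exact (contDiffAt_map_inverse (n := 1) A).differentiableAt (by norm_num)
        exact h1.comp x hL
      have habs : DifferentiableAt ℝ (fun x' => |d x'|) x :=
        (((hasDerivAt_abs hd0).comp_hasFDerivAt x hdd)).differentiableAt
      have hQ : DifferentiableAt ℝ (fun x' => |d x'| •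
          (ContinuousLinearMap.inverse (fderiv ℝ G x')) (w (G x'))) x :=
        habs.smul (hI.clm_apply (hwd.comp x hGd.differentiableAt))
      refine hQ.congr_of_eventuallyEq ?_
      filter_upwards [hw, hdet] with z h1 h2
      rw [h1]
      have hinv : (fderiv ℝ G z) =
        ((fderiv ℝ G z).toContinuousLinearEquivOfDetNeZero h2 :
          (Fin n → ℝ) →L[ℝ] (Fin n → ℝ)) := by ext1 v; simp
      have h3 : (fderiv ℝ G z).inverse ((fderiv ℝ G z) (S z)) = S z := by
        rw [hinv, ContinuousLinearMap.inverse_equiv]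
        simp only [ContinuousLinearEquiv.coe_coe]
        exact ContinuousLinearEquiv.symm_apply_apply _ _
      rw [map_smul, h3, smul_smul, mul_inv_cancel₀ (abs_ne_zero.2 h2), one_smul]
    simp [aux_pdiv, fderiv_zero_of_not_differentiableAt hwn,
      fderiv_zero_of_not_differentiableAt hS]

end helpers

/-- **Proposition 2 (second identity): reversing the change of variables for the
divergence term.** For `y = g(x,θ)`, with velocity field
`v(y,θ) = ∂_θ g(x',θ)|_{x' = g⁻¹(y,θ)}` and transformed density
`f̃(y,θ) = f(g⁻¹(y,θ),θ)|det J_{g⁻¹}(y,θ)|`, one has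
`div_y( φ(y) f̃(y,θ) v(y,θ) ) = |det J_{g⁻¹}(y,θ)| · div_x( φ(g(x,θ)) f(x,θ) s(x,θ) )`. -/
theorem transformed_divergence_change_of_variables
    {n : ℕ} (aΘ bΘ : ℝ) (hΘab : aΘ < bΘ) (Θ : Set ℝ) (hΘ : Θ = Set.Ioo aΘ bΘ)
    (Ω : Set (Fin n → ℝ)) (hΩopen : IsOpen Ω) (hΩbdd : Bornology.IsBounded Ω)
    (f : (Fin n → ℝ) → ℝ → ℝ)
    (g : (Fin n → ℝ) → ℝ → (Fin n → ℝ))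
    (W : Set (Fin n → ℝ)) (T : Set ℝ) (hWopen : IsOpen W) (hTopen : IsOpen T)
    (hWΩ : closure Ω ⊆ W) (hTΘ : closure Θ ⊆ T)
    (hf : ContDiffOn ℝ 1 (fun p : (Fin n → ℝ) × ℝ => f p.1 p.2) (W ×ˢ T))
    (hfpos : ∀ θ ∈ Θ, ∀ x ∈ Ω, 0 < f x θ)
    (hg1 : ∀ θ ∈ T, ContDiffOn ℝ 2 (fun x => g x θ) W)
    (hg2 : ∀ x ∈ W, ContDiffOn ℝ 1 (fun θ => g x θ) T)
    (hginj : ∀ θ ∈ Θ, Set.InjOn (fun x => g x θ) W)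
    (hgJ : ∀ θ ∈ Θ, ∀ x ∈ W, (jac (fun x' => g x' θ) x).det ≠ 0)
    (ginv : (Fin n → ℝ) → ℝ → (Fin n → ℝ))
    (hginv : ∀ θ ∈ Θ, ∀ x ∈ Ω, ginv (g x θ) θ = x)
    (φ : (Fin n → ℝ) → ℝ) (hφ : ContDiff ℝ 1 φ)
    (θ : ℝ) (hθ : θ ∈ Θ) (x : Fin n → ℝ) (hx : x ∈ Ω) :
    pdiv (fun y =>
        (φ y * (f (ginv y θ) θ * |(jac (fun y' => ginv y' θ) y).det|)) •
          deriv (fun t => g (ginv y θ) t) θ) (g x θ)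
      = |(jac (fun y' => ginv y' θ) (g x θ)).det|
          * pdiv (fun x' => (φ (g x' θ) * f x' θ) • svec g x' θ) x := by
  have hΩW : Ω ⊆ W := subset_closure.trans hWΩ
  have hθT : θ ∈ T := hTΘ (subset_closure hθ)
  have hG : ∀ z ∈ Ω, ContDiffAt ℝ 2 (fun x' => g x' θ) z := fun z hz =>
    (hg1 θ hθT).contDiffAt (hWopen.mem_nhds (hΩW hz))
  have hdet : ∀ z ∈ Ω, (fderiv ℝ (fun x' => g x' θ) z).det ≠ 0 := by
    intro z hz
    rw [← aux_jac_det]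
    exact hgJ θ hθ z (hΩW hz)
  have hev : ∀ z ∈ Ω, ∀ᶠ x' in nhds z, x' ∈ Ω := fun z hz => hΩopen.mem_nhds hz
  have hA : ∀ z ∈ Ω, ∃ A : (Fin n → ℝ) ≃L[ℝ] (Fin n → ℝ),
      fderiv ℝ (fun x' => g x' θ) z = A ∧ HasFDerivAt (fun y' => ginv y' θ)
        (A.symm : (Fin n → ℝ) →L[ℝ] (Fin n → ℝ)) (g z θ) := by
    intro z hz
    have hAe : fderiv ℝ (fun x' => g x' θ) z =
        ((fderiv ℝ (fun x' => g x' θ) z).toContinuousLinearEquivOfDetNeZero (hdet z hz) :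
          (Fin n → ℝ) →L[ℝ] (Fin n → ℝ)) := by ext1 v; simp
    refine ⟨_, hAe, ?_⟩
    have hs : HasStrictFDerivAt (fun x' => g x' θ)
        ((fderiv ℝ (fun x' => g x' θ) z).toContinuousLinearEquivOfDetNeZero (hdet z hz) :
          (Fin n → ℝ) →L[ℝ] (Fin n → ℝ)) z := by
      rw [← hAe]
      exact (hG z hz).hasStrictFDerivAt (by norm_num)
    refine (hs.to_local_left_inverse ?_).hasFDerivAt
    filter_upwards [hev z hz] with x' hx'
    exact hginv θ hθ x' hx'
  have hdinv : ∀ z ∈ Ω, |(jac (fun y' => ginv y' θ) (g z θ)).det| =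
      |(fderiv ℝ (fun x' => g x' θ) z).det|⁻¹ := by
    intro z hz
    obtain ⟨A, h1, h2⟩ := hA z hz
    rw [aux_jac_det, h2.fderiv, h1, ← abs_inv]
    congr 1
    apply eq_inv_of_mul_eq_one_left
    simp only [ContinuousLinearMap.det]
    rw [← LinearMap.det_comp, ← ContinuousLinearMap.toLinearMap_comp]
    simp
  obtain ⟨A, h1, h2⟩ := hA x hx
  rw [hdinv x hx]
  refine aux_main (fun x' => g x' θ) (fun y' => ginv y' θ) _ _ x (hG x hx) A h1 h2 ?_ ?_ ?_
  · filter_upwards [hev x hx] with z hz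
    exact hginv θ hθ z hz
  · filter_upwards [hev x hx] with z hz
    exact hdet z hz
  · filter_upwards [hev x hx] with z hz
    simp only [hginv θ hθ z hz]
    rw [hdinv z hz, map_smul, smul_smul]
    have : (fderiv ℝ (fun x' => g x' θ) z) (svec g z θ) = deriv (fun t => g z t) θ := by
      rw [← aux_jac_mulVec, svec, Matrix.mulVec_mulVec, Matrix.mul_nonsing_inv, Matrix.one_mulVec]
      exact isUnit_iff_ne_zero.2 (hgJ θ hθ z (hΩW hz))
    rw [this]
    congr 1
    ring
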